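/- Fractional Noether theorem for the conformable fractional optimal control problem: let 0 < α < 1, a < b, L, φ : [a,b]×ℝ×ℝ → ℝ be of class C¹, and define the Hamiltonian H(x,y,v,p) = −L(x,y,v) + p·φ(x,y,v). Let y, v, p : [a,b] → ℝ with y and p left α-differentiable, forming a conformable fractional Pontryagin extremal: for all x ∈ (a,b), y^(α)_a(x) = (∂H/∂p)(x,y(x),v(x),p(x)), p^(α)_a(x) = −(∂H/∂y)(x,y(x),v(x),p(x)), and (∂H/∂v)(x,y(x),v(x),p(x)) = 0. Let T, X, S, P, G : [a,b] → ℝ (the generators τ, ξ, σ, π and Gauge term Λ evaluated along the trajectory) with T, X, G left α-differentiable and x ↦ p(x)X(x) left α-differentiable. Fix x ∈ (a,b) and suppose invariance holds at x: the function Ψ(ε) = [ −H(x+εT(x), y(x)+εX(x), v(x)+εS(x), p(x)+εP(x)) + (p(x)+εP(x))·(y^(α)_a(x)+εX^(α)_a(x))·(x+εT(x)−a)^{1−α}/((x−a)^{1−α}+εT^(α)_a(x)) ]·(1 + εT^(α)_a(x)/(x−a)^{1−α}) satisfies Ψ(ε) = Ψ(0) + ε·G^(α)_a(x) + o(ε).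 Then (d^α_a/dx^α)[p·X](x) − T(x)·[ (∂H/∂x)(x,y(x),v(x),p(x)) + (α−1)·p(x)·y^(α)_a(x)/(x−a) ] − H(x,y(x),v(x),p(x))·T^(α)_a(x)/(x−a)^{1−α} = G^(α)_a(x). -/

import Mathlib

open Topology Filter

/-- `f` has left conformable fractional derivative `l` of order `α` starting from `a`,
at the point `x`. -/
def HasConfDerivAt (α a : ℝ) (f : ℝ → ℝ) (l x : ℝ) : Prop :=
  Filter.Tendsto (fun ε : ℝ => (f (x + ε * (x - a) ^ (1 - α)) - f x) / ε)
    (𝓝[≠] (0 : ℝ)) (𝓝 l)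

/-- The Hamiltonian of the conformable fractional optimal control problem:
`H(x,y,v,p) = −L(x,y,v) + p·φ(x,y,v)`. -/
def Ham (L φ : ℝ → ℝ → ℝ → ℝ) (x y v p : ℝ) : ℝ :=
  -L x y v + p * φ x y v

theorem hasConfDerivAt_iff_hasDerivAt {α a : ℝ} {f : ℝ → ℝ} {l x : ℝ} :
    HasConfDerivAt α a f l x ↔
      HasDerivAt (fun ε : ℝ => f (x + ε * (x - a) ^ (1 - α))) l 0 := by
  rw [hasDerivAt_iff_tendsto_slope_zero, HasConfDerivAt]
  simp [div_eq_inv_mul]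

theorem HasConfDerivAt.mul {α a : ℝ} {f g : ℝ → ℝ} {f' g' x : ℝ}
    (hf : HasConfDerivAt α a f f' x) (hg : HasConfDerivAt α a g g' x) :
    HasConfDerivAt α a (fun t => f t * g t) (f' * g x + f x * g') x := by
  rw [hasConfDerivAt_iff_hasDerivAt] at *
  simpa using hf.fun_mul hg

theorem HasConfDerivAt.unique {α a : ℝ} {f : ℝ → ℝ} {l₁ l₂ x : ℝ}
    (h₁ : HasConfDerivAt α a f l₁ x) (h₂ : HasConfDerivAt α a f l₂ x) : l₁ = l₂ :=
  tendsto_nhds_unique h₁ h₂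

/-- The derivative along a line of a differentiable function of four real variables is the
combination of its partial derivatives. -/
theorem hasDerivAt_line_of_differentiable {F : ℝ → ℝ → ℝ → ℝ → ℝ}
    (hF : Differentiable ℝ (fun q : ℝ × ℝ × ℝ × ℝ => F q.1 q.2.1 q.2.2.1 q.2.2.2))
    (x y v p T X S P : ℝ) :
    HasDerivAt (fun ε : ℝ => F (x + ε * T) (y + ε * X) (v + ε * S) (p + ε * P))
      (T * deriv (fun t => F t y v p) x + X * deriv (fun t => F x t v p) y
        + S * deriv (fun t => F x y t p) v + P * deriv (fun t => F x y v t) p) 0 := by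
  have hD := (hF (x, y, v, p)).hasFDerivAt
  set D := fderiv ℝ (fun q : ℝ × ℝ × ℝ × ℝ => F q.1 q.2.1 q.2.2.1 q.2.2.2) (x, y, v, p)
  have h1 : deriv (fun t => F t y v p) x = D (1, 0, 0, 0) :=
    (hD.comp_hasDerivAt (f := fun t => (t, y, v, p)) x
      ((hasDerivAt_id x).prodMk (hasDerivAt_const x (y, v, p)))).deriv
  have h2 : deriv (fun t => F x t v p) y = D (0, 1, 0, 0) :=
    (hD.comp_hasDerivAt (f := fun t => (x, t, v, p)) y
      ((hasDerivAt_const y x).prodMk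
        ((hasDerivAt_id y).prodMk (hasDerivAt_const y (v, p))))).deriv
  have h3 : deriv (fun t => F x y t p) v = D (0, 0, 1, 0) :=
    (hD.comp_hasDerivAt (f := fun t => (x, y, t, p)) v
      ((hasDerivAt_const v x).prodMk ((hasDerivAt_const v y).prodMk
        ((hasDerivAt_id v).prodMk (hasDerivAt_const v p))))).deriv
  have h4 : deriv (fun t => F x y v t) p = D (0, 0, 0, 1) :=
    (hD.comp_hasDerivAt (f := fun t => (x, y, v, t)) p
      ((hasDerivAt_const p x).prodMk ((hasDerivAt_const p y).prodMk
        ((hasDerivAt_const p v).prodMk (hasDerivAt_id p))))).deriv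
  have hline (c d : ℝ) : HasDerivAt (fun ε : ℝ => c + ε * d) d 0 := by
    simpa using ((hasDerivAt_id (0 : ℝ)).mul_const d).const_add c
  have hcurve := (hline x T).prodMk ((hline y X).prodMk ((hline v S).prodMk (hline p P)))
  have hcomp := HasFDerivAt.comp_hasDerivAt_of_eq 0 hD hcurve (by simp)
  have hdir : ((T, X, S, P) : ℝ × ℝ × ℝ × ℝ) =
      T • (1, 0, 0, 0) + X • (0, 1, 0, 0) + S • (0, 0, 1, 0) + P • (0, 0, 0, 1) := by
    simp
  rw [hdir] at hcomp
  simp only [map_add, map_smul, smul_eq_mul] at hcomp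
  rw [h1, h2, h3, h4]
  exact hcomp

theorem differentiable_ham {L φ : ℝ → ℝ → ℝ → ℝ}
    (hL : Differentiable ℝ (fun q : ℝ × ℝ × ℝ => L q.1 q.2.1 q.2.2))
    (hφ : Differentiable ℝ (fun q : ℝ × ℝ × ℝ => φ q.1 q.2.1 q.2.2)) :
    Differentiable ℝ (fun q : ℝ × ℝ × ℝ × ℝ => Ham L φ q.1 q.2.1 q.2.2.1 q.2.2.2) := by
  have hproj : Differentiable ℝ
      (fun q : ℝ × ℝ × ℝ × ℝ => ((q.1, q.2.1, q.2.2.1) : ℝ × ℝ × ℝ)) := by fun_prop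
  have hp : Differentiable ℝ (fun q : ℝ × ℝ × ℝ × ℝ => q.2.2.2) := by fun_prop
  exact (hL.comp hproj).neg.add (hp.mul (hφ.comp hproj))

/-- Fractional Noether theorem for the conformable fractional optimal control problem:
if `(y,v,p)` is a conformable fractional Pontryagin extremal and the problem is
invariant at `x` under `x̄ = x+ετ`, `ȳ = y+εξ`, `v̄ = v+εσ`, `p̄ = p+επ` up to the Gauge
term `Λ` (the Hamiltonian invariance identity up to `o(ε)`, expressed as a
derivative-at-`0` condition on `Ψ`), then
`(d^α_a/dx^α)[pξ] − τ[∂H/∂x + (α−1)p·y^{(α)}_a/(x−a)] − H·τ^{(α)}_a/(x−a)^{1−α} = Λ^{(α)}_a`.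
Here `T,X,S,P,G` denote `τ, ξ, σ, π, Λ` evaluated along the trajectory. -/
theorem conformable_optimal_control_noether
    (α a b : ℝ) (hα0 : 0 < α) (hα1 : α < 1) (hab : a < b)
    (L φ : ℝ → ℝ → ℝ → ℝ)
    (hL : ContDiff ℝ 1 (fun q : ℝ × ℝ × ℝ => L q.1 q.2.1 q.2.2))
    (hφ : ContDiff ℝ 1 (fun q : ℝ × ℝ × ℝ => φ q.1 q.2.1 q.2.2))
    (y v p yα pα : ℝ → ℝ)
    (hy : ∀ t ∈ Set.Ioo a b, HasConfDerivAt α a y (yα t) t)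
    (hp : ∀ t ∈ Set.Ioo a b, HasConfDerivAt α a p (pα t) t)
    (hH1 : ∀ t ∈ Set.Ioo a b,
      yα t = deriv (fun ψ => Ham L φ t (y t) (v t) ψ) (p t))
    (hH2 : ∀ t ∈ Set.Ioo a b,
      pα t = -deriv (fun u => Ham L φ t u (v t) (p t)) (y t))
    (hH3 : ∀ t ∈ Set.Ioo a b,
      deriv (fun w => Ham L φ t (y t) w (p t)) (v t) = 0)
    (T X S P G Tα Xα Gα pXα : ℝ → ℝ)
    (x : ℝ) (hx : x ∈ Set.Ioo a b)
    (hT : HasConfDerivAt α a T (Tα x) x)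
    (hX : HasConfDerivAt α a X (Xα x) x)
    (hG : HasConfDerivAt α a G (Gα x) x)
    (hpX : HasConfDerivAt α a (fun t => p t * X t) (pXα x) x)
    (hinv : HasDerivAt (fun ε : ℝ =>
      (-Ham L φ (x + ε * T x) (y x + ε * X x) (v x + ε * S x) (p x + ε * P x)
          + (p x + ε * P x) *
            ((yα x + ε * Xα x) * (x + ε * T x - a) ^ (1 - α) /
              ((x - a) ^ (1 - α) + ε * Tα x))) *
        (1 + ε * Tα x / (x - a) ^ (1 - α))) (Gα x) 0) :
    pXα x
      - T x * (deriv (fun t => Ham L φ t (y x) (v x) (p x)) x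
          + (α - 1) * p x * yα x / (x - a))
      - Ham L φ x (y x) (v x) (p x) * Tα x / (x - a) ^ (1 - α) = Gα x := by
  have hxa : 0 < x - a := sub_pos.mpr hx.1
  have hw : 0 < (x - a) ^ (1 - α) := Real.rpow_pos_of_pos hxa _
  have hprod : pXα x = pα x * X x + p x * Xα x := hpX.unique ((hp x hx).mul hX)
  have hHam := hasDerivAt_line_of_differentiable
    (differentiable_ham (hL.differentiable one_ne_zero) (hφ.differentiable one_ne_zero))
    x (y x) (v x) (p x) (T x) (X x) (S x) (P x)
  rw [hH3 x hx, ← hH1 x hx, ← neg_eq_iff_eq_neg.mpr (hH2 x hx)] at hHam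
  have hline (c d : ℝ) : HasDerivAt (fun ε : ℝ => c + ε * d) d 0 := by
    simpa using ((hasDerivAt_id (0 : ℝ)).mul_const d).const_add c
  have hpow : HasDerivAt (fun ε : ℝ => (x + ε * T x - a) ^ (1 - α))
      (T x * (1 - α) * ((x - a) ^ (1 - α) / (x - a))) 0 := by
    have h := ((hline x (T x)).sub_const a).rpow_const (p := 1 - α)
      (Or.inl (by simpa using hxa.ne'))
    simpa only [zero_mul, add_zero, Real.rpow_sub_one hxa.ne'] using h
  have hquot := ((hline (yα x) (Xα x)).fun_mul hpow).fun_div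
    (hline ((x - a) ^ (1 - α)) (Tα x)) (by simpa using hw.ne')
  have hjac : HasDerivAt (fun ε : ℝ => 1 + ε * Tα x / (x - a) ^ (1 - α))
      (Tα x / (x - a) ^ (1 - α)) 0 := by
    simpa only [mul_div_assoc] using hline 1 (Tα x / (x - a) ^ (1 - α))
  have hΨ := (hHam.fun_neg.fun_add ((hline (p x) (P x)).fun_mul hquot)).fun_mul hjac
  rw [hinv.unique hΨ, hprod]
  simp only [zero_mul, add_zero, zero_div]
  field_simp
  ring
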